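/- If G is a graph of order n with clique number ω(G) = ω, then q(G) ≤ (2(ω−1)/ω)·n + 8. -/

import Mathlib

open Matrix SimpleGraph Finset BigOperators

variable {V : Type*}

noncomputable def signlessLap (G : SimpleGraph V) [Fintype V] [DecidableEq V]
    [DecidableRel G.Adj] : Matrix V V ℝ :=
  Matrix.diagonal (fun v => (G.degree v : ℝ)) + G.adjMatrix ℝ

theorem signlessLap_isHermitian (G : SimpleGraph V) [Fintype V] [DecidableEq V]
    [DecidableRel G.Adj] : (signlessLap G).IsHermitian := by
  unfold signlessLap
  apply Matrix.IsHermitian.add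
  · exact Matrix.isHermitian_diagonal _
  · ext i j
    simp [Matrix.conjTranspose_apply, SimpleGraph.adjMatrix_apply, adj_comm]

noncomputable def qIndex (G : SimpleGraph V) [Fintype V] [DecidableEq V]
    [DecidableRel G.Adj] : ℝ :=
  ⨆ i, (signlessLap_isHermitian G).eigenvalues i

/-- **Motzkin–Straus reduction.** If `f` is affine along each exchange of mass between two
nonadjacent vertices, then on the standard simplex `f` is dominated by its values at points
supported on cliques. -/
theorem exists_clique_support_ge [Fintype V] [DecidableEq V] (G : SimpleGraph V)
    (f : (V → ℝ) → ℝ)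
    (hf : ∀ u v, u ≠ v → ¬ G.Adj u v → ∀ m, ∃ k, ∀ t : ℝ,
      f (m + t • (Pi.single u 1 - Pi.single v 1)) = f m + t * k)
    (m : V → ℝ) (hm : m ∈ stdSimplex ℝ V) :
    ∃ m' ∈ stdSimplex ℝ V, G.IsClique {i | m' i ≠ 0} ∧ f m ≤ f m' := by
  induction hs : (univ.filter fun i => m i ≠ 0).card using Nat.strong_induction_on
    generalizing m with
  | _ N ih =>
  by_cases hc : G.IsClique {i | m i ≠ 0}
  · exact ⟨m, hm, hc, le_rfl⟩
  -- Moving all the mass of `b` to `a` shrinks the support.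
  have move : ∀ a b, a ≠ b → m a ≠ 0 → m b ≠ 0 →
      f m ≤ f (m + m b • (Pi.single a 1 - Pi.single b 1)) →
      ∃ m' ∈ stdSimplex ℝ V, G.IsClique {i | m' i ≠ 0} ∧ f m ≤ f m' := by
    intro a b hab ha hb hle
    have hval : ∀ i, (m + m b • (Pi.single a 1 - Pi.single b 1) : V → ℝ) i =
        if i = a then m a + m b else if i = b then 0 else m i := by
      intro i
      by_cases hia : i = a
      · subst hia; simp [hab]
      · by_cases hib : i = b
        · subst hib; simp [hia]
        · simp [hia, hib]
    have hlt : (univ.filter fun i =>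
        (m + m b • (Pi.single a 1 - Pi.single b 1) : V → ℝ) i ≠ 0).card < N := by
      rw [← hs]
      refine card_lt_card ⟨fun i hi => ?_, fun h => ?_⟩
      · rw [mem_filter, hval] at hi
        rw [mem_filter]
        refine ⟨mem_univ _, ?_⟩
        have := hi.2
        split_ifs at this with h₁ h₂
        · rwa [h₁]
        · exact absurd rfl this
        · exact this
      · have := h (mem_filter.2 ⟨mem_univ b, hb⟩)
        rw [mem_filter, hval] at this
        simp [hab.symm] at this
    have hmem : m + m b • (Pi.single a 1 - Pi.single b 1) ∈ stdSimplex ℝ V := by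
      refine ⟨fun i => ?_, ?_⟩
      · rw [hval]
        have := hm.1 a
        have := hm.1 b
        have := hm.1 i
        split_ifs <;> linarith
      · simp [sum_add_distrib, ← mul_sum, hm.2]
    obtain ⟨m', h₁, h₂, h₃⟩ := ih _ hlt _ hmem rfl
    exact ⟨m', h₁, h₂, hle.trans h₃⟩
  simp only [SimpleGraph.IsClique, Set.Pairwise] at hc
  push Not at hc
  obtain ⟨u, hu, v, hv, huv, hadj⟩ := hc
  obtain ⟨k, hk⟩ := hf u v huv hadj m
  rcases le_total 0 k with h0 | h0
  · refine move u v huv hu hv ?_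
    rw [hk]
    have := mul_nonneg (hm.1 v) h0
    linarith
  · refine move v u huv.symm hv hu ?_
    have : m u • (Pi.single v 1 - Pi.single u 1 : V → ℝ) =
        (-m u) • (Pi.single u 1 - Pi.single v 1) := by
      rw [neg_smul, ← smul_neg, neg_sub]
    rw [this, hk]
    have := mul_nonneg_of_nonpos_of_nonpos (neg_nonpos.2 (hm.1 u)) h0
    linarith

/-- A point of the standard simplex supported on at most `1 / b` vertices satisfies a
strengthened Cauchy–Schwarz inequality. -/
theorem sq_sum_mul_le_of_card_support_le [Fintype V] [DecidableEq V] (m x : V → ℝ)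
    (hm : m ∈ stdSimplex ℝ V) (b : ℝ) (hb0 : 0 ≤ b)
    (hcard : ((univ.filter fun i => m i ≠ 0).card : ℝ) * b ≤ 1) :
    (∑ i, m i * x i) ^ 2 ≤
      (1 - 2 * b) * ∑ i, m i * x i ^ 2 + 2 * ∑ i, m i ^ 2 * x i ^ 2 := by
  set s := univ.filter fun i => m i ≠ 0 with hs
  have hsub : ∀ g : V → ℝ, (∀ i, m i = 0 → g i = 0) → ∑ i, g i = ∑ i ∈ s, g i := by
    intro g hg
    refine (sum_subset (subset_univ s) fun i _ hi => hg i ?_).symm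
    simpa [hs] using hi
  have hsum : ∑ i ∈ s, m i = 1 := by rw [← hsub m fun _ h => h, hm.2]
  rw [hsub _ fun i h => by simp [h], hsub (fun i => m i * x i ^ 2) fun i h => by simp [h],
    hsub (fun i => m i ^ 2 * x i ^ 2) fun i h => by simp [h]]
  rcases Nat.lt_or_ge s.card 2 with hlt | hge
  · have hpos : s.card ≠ 0 := by
      intro h
      rw [card_eq_zero.1 h] at hsum
      simp at hsum
    obtain ⟨i, hi⟩ := card_eq_one.1 (show s.card = 1 by omega)
    rw [hi] at hsum hcard ⊢
    simp only [sum_singleton, card_singleton, Nat.cast_one, one_mul] at hsum hcard ⊢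
    rw [hsum]
    nlinarith [sq_nonneg (x i)]
  · have ha : 0 ≤ 1 - 2 * b := by
      have : (2 : ℝ) ≤ s.card := by exact_mod_cast hge
      nlinarith
    have key := sum_sq_le_sum_mul_sum_of_sq_le_mul s (r := fun i => m i * x i)
      (f := fun i => 2 * b ^ 2 + (1 - 2 * b) * m i)
      (g := fun i => (1 - 2 * b) * (m i * x i ^ 2) + 2 * (m i ^ 2 * x i ^ 2))
      (fun i _ => by have := hm.1 i; positivity)
      (fun i _ => by have := hm.1 i; positivity)
      (fun i _ => by
        have h₁ : 0 ≤ 2 * (1 - 2 * b) * (m i - b) ^ 2 * (m i * x i ^ 2) := by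
          have := hm.1 i
          positivity
        linarith)
    rw [sum_add_distrib, sum_add_distrib, sum_const, nsmul_eq_mul, ← mul_sum, ← mul_sum,
      ← mul_sum, hsum] at key
    refine key.trans (mul_le_of_le_one_left ?_ ?_)
    · have h₁ : 0 ≤ ∑ i ∈ s, m i * x i ^ 2 :=
        sum_nonneg fun i _ => mul_nonneg (hm.1 i) (sq_nonneg _)
      have h₂ : 0 ≤ ∑ i ∈ s, m i ^ 2 * x i ^ 2 := sum_nonneg fun i _ => by positivity
      positivity
    · nlinarith [mul_le_mul_of_nonneg_right hcard hb0]

/-- Weighted form of the clique bound for the signless Laplacian quadratic form. -/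
theorem sum_adj_mul_add_sq_le [Fintype V] [DecidableEq V] [Nonempty V] (G : SimpleGraph V)
    [DecidableRel G.Adj] (x m : V → ℝ) (hm : m ∈ stdSimplex ℝ V) :
    ∑ i, ∑ j, (if G.Adj i j then m i * m j * (x i + x j) ^ 2 else 0) ≤
      4 * (1 - 1 / (G.cliqueNum : ℝ)) * ∑ i, m i * x i ^ 2 := by
  set b : ℝ := 1 / (G.cliqueNum : ℝ) with hb
  set B : Matrix V V ℝ := Matrix.of fun i j => if G.Adj i j then (x i + x j) ^ 2 else 0 with hB
  set c : V → ℝ := fun i => 4 * (1 - b) * x i ^ 2 with hc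
  have hform : ∀ m : V → ℝ, m ⬝ᵥ B *ᵥ m =
      ∑ i, ∑ j, (if G.Adj i j then m i * m j * (x i + x j) ^ 2 else 0) := by
    intro m
    simp only [dotProduct, mulVec, mul_sum, hB, Matrix.of_apply]
    refine sum_congr rfl fun i _ => sum_congr rfl fun j _ => ?_
    split_ifs <;> ring
  have hlin : ∀ m : V → ℝ, c ⬝ᵥ m = 4 * (1 - b) * ∑ i, m i * x i ^ 2 := by
    intro m
    simp only [dotProduct, mul_sum, hc]
    exact sum_congr rfl fun i _ => by ring
  obtain ⟨m', hm', hclique, hle⟩ := exists_clique_support_ge G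
    (fun m => m ⬝ᵥ B *ᵥ m - c ⬝ᵥ m) (fun u v _ hadj m => by
      set d : V → ℝ := Pi.single u 1 - Pi.single v 1 with hd
      have hdd : d ⬝ᵥ B *ᵥ d = 0 := by
        have hadj' : ¬ G.Adj v u := fun h => hadj h.symm
        simp [hd, mulVec_sub, sub_dotProduct, hB, hadj, hadj']
      refine ⟨d ⬝ᵥ B *ᵥ m + m ⬝ᵥ B *ᵥ d - c ⬝ᵥ d, fun t => ?_⟩
      simp only [mulVec_add, mulVec_smul, dotProduct_add, add_dotProduct, smul_dotProduct,
        dotProduct_smul, hdd, smul_eq_mul]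
      ring) m hm
  simp only [hform, hlin] at hle
  have hcard : ((univ.filter fun i => m' i ≠ 0).card : ℝ) * b ≤ 1 := by
    have h : (univ.filter fun i => m' i ≠ 0).card ≤ G.cliqueNum :=
      SimpleGraph.IsClique.card_le_cliqueNum (tc := by simpa using hclique)
    rw [hb, mul_one_div]
    exact div_le_one_of_le₀ (by exact_mod_cast h) (Nat.cast_nonneg _)
  have hcs := sq_sum_mul_le_of_card_support_le m' x hm' b (by positivity) hcard
  have hexp : ∑ i, ∑ j, (if G.Adj i j then m' i * m' j * (x i + x j) ^ 2 else 0) =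
      2 * ∑ i, m' i * x i ^ 2 + 2 * (∑ i, m' i * x i) ^ 2 - 4 * ∑ i, m' i ^ 2 * x i ^ 2 := by
    have h₁ : ∀ i j, (if G.Adj i j then m' i * m' j * (x i + x j) ^ 2 else 0) =
        m' i * x i ^ 2 * m' j + m' i * (m' j * x j ^ 2) + 2 * ((m' i * x i) * (m' j * x j)) -
          if i = j then 4 * (m' i ^ 2 * x i ^ 2) else 0 := by
      intro i j
      by_cases hij : i = j
      · subst hij
        simp only [SimpleGraph.irrefl, if_false, if_true]
        ring
      · by_cases hi : m' i = 0
        · simp [hi]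
        · by_cases hj : m' j = 0
          · simp [hj, hij]
          · have := hclique hi hj hij
            simp only [this, hij, if_true, if_false]
            ring
    simp only [h₁, sum_sub_distrib, sum_add_distrib, ← mul_sum, ← sum_mul, hm'.2, sum_ite_eq,
      mem_univ, if_true]
    ring
  rw [hexp] at hle
  linarith

theorem two_mul_dotProduct_signlessLap_mulVec [Fintype V] [DecidableEq V] (G : SimpleGraph V)
    [DecidableRel G.Adj] (x : V → ℝ) :
    2 * (x ⬝ᵥ signlessLap G *ᵥ x) = ∑ i, ∑ j, if G.Adj i j then (x i + x j) ^ 2 else 0 := by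
  have hdeg : ∀ i, (G.degree i : ℝ) = ∑ j, if G.Adj i j then (1 : ℝ) else 0 := by
    intro i
    rw [sum_boole, ← G.neighborFinset_eq_filter, G.card_neighborFinset_eq_degree]
  have hQ : x ⬝ᵥ signlessLap G *ᵥ x =
      ∑ i, ∑ j, if G.Adj i j then x i ^ 2 + x i * x j else 0 := by
    simp only [signlessLap, add_mulVec, dotProduct_add]
    simp only [dotProduct, mulVec_diagonal, ← sum_add_distrib]
    refine sum_congr rfl fun i _ => ?_
    simp only [mulVec, dotProduct, hdeg, mul_sum, sum_mul, ← sum_add_distrib]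
    refine sum_congr rfl fun j _ => ?_
    rw [G.adjMatrix_apply]
    split_ifs <;> ring
  have hQ' := hQ
  rw [sum_comm] at hQ'
  rw [two_mul]
  nth_rewrite 1 [hQ]
  rw [hQ', ← sum_add_distrib]
  refine sum_congr rfl fun i _ => ?_
  rw [← sum_add_distrib]
  refine sum_congr rfl fun j _ => ?_
  simp only [G.adj_comm j i]
  split_ifs <;> ring

theorem dotProduct_signlessLap_mulVec_le [Fintype V] [DecidableEq V] [Nonempty V]
    (G : SimpleGraph V) [DecidableRel G.Adj] (x : V → ℝ) :
    x ⬝ᵥ signlessLap G *ᵥ x ≤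
      2 * (1 - 1 / (G.cliqueNum : ℝ)) * (Fintype.card V : ℝ) * (x ⬝ᵥ x) := by
  set n : ℝ := (Fintype.card V : ℝ) with hn
  have hpos : 0 < n := by rw [hn]; exact_mod_cast Fintype.card_pos
  have h := sum_adj_mul_add_sq_le G x (fun _ => n⁻¹)
    ⟨fun _ => by positivity, by simp [← hn, hpos.ne']⟩
  have h₁ : ∑ i, ∑ j, (if G.Adj i j then n⁻¹ * n⁻¹ * (x i + x j) ^ 2 else 0) =
      n⁻¹ * n⁻¹ * (2 * (x ⬝ᵥ signlessLap G *ᵥ x)) := by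
    simp only [two_mul_dotProduct_signlessLap_mulVec, mul_sum, mul_ite, mul_zero]
  have h₂ : ∑ i, n⁻¹ * x i ^ 2 = n⁻¹ * (x ⬝ᵥ x) := by
    simp only [dotProduct, mul_sum, sq]
  rw [h₁, h₂] at h
  have h₃ := mul_le_mul_of_nonneg_left h (mul_self_nonneg n)
  field_simp at h₃ ⊢
  linarith

theorem stmt5 (G : SimpleGraph V) [Fintype V] [DecidableEq V] [DecidableRel G.Adj]
    [Nonempty V] :
    qIndex G ≤ 2 * ((G.cliqueNum : ℝ) - 1) / (G.cliqueNum : ℝ) * (Fintype.card V : ℝ) + 8 := by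
  have hω : (G.cliqueNum : ℝ) ≠ 0 := by
    obtain ⟨v⟩ := ‹Nonempty V›
    have h : ({v} : Finset V).card ≤ G.cliqueNum :=
      SimpleGraph.IsClique.card_le_cliqueNum (tc := by simp)
    rw [card_singleton] at h
    exact_mod_cast (by omega : G.cliqueNum ≠ 0)
  refine ciSup_le fun i => ?_
  set x : V → ℝ := ⇑((signlessLap_isHermitian G).eigenvectorBasis i) with hx
  have hx0 : 0 < x ⬝ᵥ x := by
    refine lt_of_le_of_ne (sum_nonneg fun j _ => mul_self_nonneg _) fun h => ?_
    refine (signlessLap_isHermitian G).eigenvectorBasis.toBasis.ne_zero i ?_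
    have := dotProduct_self_eq_zero.1 h.symm
    ext j
    simpa [hx] using congrFun this j
  have h := dotProduct_signlessLap_mulVec_le G x
  rw [hx, (signlessLap_isHermitian G).mulVec_eigenvectorBasis i, ← hx, dotProduct_smul,
    smul_eq_mul] at h
  have h' := le_of_mul_le_mul_right h hx0
  have : 2 * ((G.cliqueNum : ℝ) - 1) / (G.cliqueNum : ℝ) = 2 * (1 - 1 / (G.cliqueNum : ℝ)) := by
    field_simp
  rw [this]
  linarith
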